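/- Under the uniform local ℓ_p stability assumption and the stated conditions on α and γ, the value functions V and W are robust Lyapunov functions in the following sense: V({x}) > 0 and W({x}) > 0 for all x ∉ 𝒜; V({x}) = W({x}) = 0 for all x ∈ 𝒜; and for all x ∈ D̃ \ 𝒜, V({x}) − sup_{w∈W} V({f(x,w)}) > 0 and W({x}) − sup_{w∈W} W({f(x,w)}) > 0. -/

import Mathlib

open Metric Set Filter Topology TopologicalSpace ENNReal

noncomputable section

abbrev Euc (n : ℕ) : Type := EuclideanSpace ℝ (Fin n)

/-- Trajectory of the discrete-time uncertain system `x_{k+1} = f (x_k) (w_k)`. -/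
def traj {n m : ℕ} (f : Euc n → Euc m → Euc n) (x : Euc n) (π : ℕ → Euc m) : ℕ → Euc n
  | 0 => x
  | k + 1 => f (traj f x π k) (π k)

/-- Reachable set of `X` at time `k` under disturbance signals taking values in `W`. -/
def reach {n m : ℕ} (f : Euc n → Euc m → Euc n) (W : Set (Euc m)) (X : Set (Euc n)) (k : ℕ) :
    Set (Euc n) :=
  {y | ∃ x ∈ X, ∃ π : ℕ → Euc m, (∀ j, π j ∈ W) ∧ y = traj f x π k}

/-- The one-step set-valued map `F(X) = {f x w : x ∈ X, w ∈ W}`. -/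
def Fmap {n m : ℕ} (f : Euc n → Euc m → Euc n) (W : Set (Euc m)) (X : Set (Euc n)) :
    Set (Euc n) :=
  Set.image2 f X W

/-- Asymmetric (directed) Hausdorff distance `sup_{x ∈ A} dist(x, B)`. -/
def dHa {n : ℕ} (A B : Set (Euc n)) : ℝ := ⨆ x : A, Metric.infDist (x : Euc n) B

/-- Uniform local ℓ_p stability of the robust invariant set `𝒜` within the safe set `𝒳`. -/
structure LpStable {n m : ℕ} (f : Euc n → Euc m → Euc n) (W : Set (Euc m))
    (𝒳 𝒜 : Set (Euc n)) where
  r : ℝ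
  M : ℝ
  p : ℝ
  lam : ℝ → ℕ → ℝ
  r_pos : 0 < r
  M_ge_one : 1 ≤ M
  p_pos : 0 < p
  lam_nonneg : ∀ s ∈ Set.Icc (0 : ℝ) r, ∀ k : ℕ, 0 ≤ lam s k
  lam_cont : ∀ k : ℕ, ContinuousOn (fun s => lam s k) (Set.Icc (0 : ℝ) r)
  lam_mono : ∀ k : ℕ, MonotoneOn (fun s => lam s k) (Set.Icc (0 : ℝ) r)
  lam_zero : ∀ k : ℕ, lam 0 k = 0
  lam_anti : ∀ s ∈ Set.Icc (0 : ℝ) r, ∀ k l : ℕ, k ≤ l → lam s l ≤ lam s k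
  lam_le_id : ∀ s ∈ Set.Icc (0 : ℝ) r, lam s 0 ≤ s
  lam_summable : Summable fun k : ℕ => lam r k ^ p
  stab : ∀ x ∈ 𝒳, Metric.infDist x 𝒜 ≤ r →
    ∀ π : ℕ → Euc m, (∀ j, π j ∈ W) →
      ∀ k : ℕ, Metric.infDist (traj f x π k) 𝒜 ≤ M * lam (Metric.infDist x 𝒜) k

/-- The safe robust domain of uniform attraction. -/
def DOUA {n m : ℕ} (f : Euc n → Euc m → Euc n) (W : Set (Euc m)) (𝒳 𝒜 : Set (Euc n)) :
    Set (Euc n) :=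
  {x | (∀ k : ℕ, reach f W {x} k ⊆ 𝒳) ∧
    Filter.Tendsto (fun k => dHa (reach f W {x} k) 𝒜) Filter.atTop (nhds 0)}

/-- The safe robust domain of attraction. -/
def DOA {n m : ℕ} (f : Euc n → Euc m → Euc n) (W : Set (Euc m)) (𝒳 𝒜 : Set (Euc n)) :
    Set (Euc n) :=
  {x | ∀ π : ℕ → Euc m, (∀ j, π j ∈ W) →
    (∀ k : ℕ, traj f x π k ∈ 𝒳) ∧
      Filter.Tendsto (fun k => Metric.infDist (traj f x π k) 𝒜) Filter.atTop (nhds 0)}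

/-- `Ψ(X) = (sup_{y∈X} γ y) * (sup_{y∈X} α y)`. -/
def Psi {n : ℕ} (α : Euc n → ℝ) (γ : Euc n → ℝ≥0∞) (X : Set (Euc n)) : ℝ≥0∞ :=
  (⨆ y : X, γ (y : Euc n)) * ENNReal.ofReal (⨆ y : X, α (y : Euc n))

/-- The value function `V(X) = Σ_k Ψ(R(X,k))`. -/
def Vval {n m : ℕ} (f : Euc n → Euc m → Euc n) (W : Set (Euc m)) (α : Euc n → ℝ)
    (γ : Euc n → ℝ≥0∞) (X : Set (Euc n)) : ℝ≥0∞ :=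
  ∑' k : ℕ, Psi α γ (reach f W X k)

/-- `exp(-a)` for `a ∈ [0,∞]`, with `exp(-∞) = 0`. -/
def expNeg (a : ℝ≥0∞) : ℝ := if a = ⊤ then 0 else Real.exp (-a.toReal)

/-- The value function `W(X) = 1 - exp(-V(X))`. -/
def Wval {n m : ℕ} (f : Euc n → Euc m → Euc n) (W : Set (Euc m)) (α : Euc n → ℝ)
    (γ : Euc n → ℝ≥0∞) (X : Set (Euc n)) : ℝ :=
  1 - expNeg (Vval f W α γ X)

/-- `ξ(X) = 1 - exp(-Ψ(X))`. -/
def xival {n : ℕ} (α : Euc n → ℝ) (γ : Euc n → ℝ≥0∞) (X : Set (Euc n)) : ℝ :=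
  1 - expNeg (Psi α γ X)

/-- `β(X) = exp(Ψ(X)) - 1`. -/
def betaval {n : ℕ} (α : Euc n → ℝ) (γ : Euc n → ℝ≥0∞) (X : Set (Euc n)) : ℝ :=
  Real.exp ((Psi α γ X).toReal) - 1

/-- Conditions on `α`: continuous with `α̲ dist(x,𝒜)^p̄ ≤ α(x) ≤ ᾱ dist(x,𝒜)^p̄`. -/
def AlphaHyp {n : ℕ} (𝒜 : Set (Euc n)) (α : Euc n → ℝ) (αlow αup pbar : ℝ) : Prop :=
  Continuous α ∧ 0 < αlow ∧ αlow ≤ αup ∧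
    ∀ x : Euc n, αlow * Metric.infDist x 𝒜 ^ pbar ≤ α x ∧
      α x ≤ αup * Metric.infDist x 𝒜 ^ pbar

/-- Conditions on `γ`: finite, continuous and `≥ γ̲ > 0` on `𝒳`, `= ∞` outside `𝒳`,
blowing up along sequences converging to the boundary of `𝒳`. -/
def GammaHyp {n : ℕ} (𝒳 : Set (Euc n)) (γ : Euc n → ℝ≥0∞) (γlow : ℝ) : Prop :=
  (∀ x ∈ 𝒳, γ x ≠ ⊤) ∧ ContinuousOn γ 𝒳 ∧ 0 < γlow ∧
    (∀ x ∈ 𝒳, ENNReal.ofReal γlow ≤ γ x) ∧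
    (∀ x ∉ 𝒳, γ x = ⊤) ∧
    ∀ (u : ℕ → Euc n) (x : Euc n), x ∈ frontier 𝒳 →
      Filter.Tendsto u Filter.atTop (nhds x) →
      Filter.Tendsto (fun k => γ (u k)) Filter.atTop (nhds ⊤)

theorem aux_traj_congr {n m : ℕ} (f : Euc n → Euc m → Euc n) (x : Euc n) (π π' : ℕ → Euc m)
    (k : ℕ) (h : ∀ j < k, π j = π' j) : traj f x π k = traj f x π' k := by
  induction k with
  | zero => rfl
  | succ k ih =>
    simp only [traj]
    rw [ih (fun j hj => h j (by omega)), h k (by omega)]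

theorem aux_traj_add {n m : ℕ} (f : Euc n → Euc m → Euc n) (x : Euc n) (π : ℕ → Euc m)
    (N k : ℕ) : traj f x π (N + k) = traj f (traj f x π N) (fun j => π (N + j)) k := by
  induction k with
  | zero => rfl
  | succ k ih =>
    rw [← add_assoc]
    simp only [traj]
    rw [ih]

theorem aux_reach_zero {n m : ℕ} (f : Euc n → Euc m → Euc n) (W : Set (Euc m))
    (hW : W.Nonempty) (X : Set (Euc n)) : reach f W X 0 = X := by
  obtain ⟨w, hw⟩ := hW
  ext y
  constructor
  · rintro ⟨x, hx, π, hπ, rfl⟩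
    exact hx
  · intro hy
    exact ⟨y, hy, fun _ => w, fun _ => hw, rfl⟩

theorem aux_reach_succ {n m : ℕ} (f : Euc n → Euc m → Euc n) (W : Set (Euc m))
    (X : Set (Euc n)) (k : ℕ) :
    reach f W X (k + 1) = (fun p : Euc n × Euc m => f p.1 p.2) '' (reach f W X k ×ˢ W) := by
  ext y
  constructor
  · rintro ⟨x, hx, π, hπ, rfl⟩
    exact ⟨(traj f x π k, π k), ⟨⟨x, hx, π, hπ, rfl⟩, hπ k⟩, rfl⟩
  · rintro ⟨⟨z, w⟩, ⟨⟨x, hx, π, hπ, hz⟩, hw⟩, rfl⟩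
    refine ⟨x, hx, fun j => if j < k then π j else w, ?_, ?_⟩
    · intro j
      by_cases hj : j < k
      · simpa [hj] using hπ j
      · simpa [hj] using hw
    · simp only [traj] at hz ⊢
      rw [← aux_traj_congr f x π (fun j => if j < k then π j else w) k
        (fun j hj => by simp [hj]), ← hz]
      simp

theorem aux_reach_compact {n m : ℕ} (f : Euc n → Euc m → Euc n)
    (hf : Continuous fun p : Euc n × Euc m => f p.1 p.2) (W : Set (Euc m))
    (hWne : W.Nonempty) (hW : IsCompact W) (X : Set (Euc n)) (hX : IsCompact X) (k : ℕ) :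
    IsCompact (reach f W X k) := by
  induction k with
  | zero => rwa [aux_reach_zero f W hWne]
  | succ k ih =>
    rw [aux_reach_succ]
    exact (ih.prod hW).image hf

theorem aux_reach_nonempty {n m : ℕ} (f : Euc n → Euc m → Euc n) (W : Set (Euc m))
    (hWne : W.Nonempty) (x : Euc n) (k : ℕ) : (reach f W {x} k).Nonempty := by
  obtain ⟨w, hw⟩ := hWne
  exact ⟨_, x, rfl, fun _ => w, fun _ => hw, rfl⟩

theorem aux_reach_step {n m : ℕ} (f : Euc n → Euc m → Euc n) (W : Set (Euc m))
    (x : Euc n) (w : Euc m) (hw : w ∈ W) (k : ℕ) :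
    reach f W {f x w} k ⊆ reach f W {x} (k + 1) := by
  rintro y ⟨z, rfl, π, hπ, rfl⟩
  refine ⟨x, rfl, fun j => Nat.casesOn j w π, ?_, ?_⟩
  · rintro (_ | j)
    · exact hw
    · exact hπ j
  · rw [add_comm k 1, aux_traj_add]
    have : (fun j => (fun j => Nat.casesOn j w π : ℕ → Euc m) (1 + j)) = π := by
      funext j
      rw [add_comm]
    rw [this]
    rfl

theorem aux_bdd {n : ℕ} (g : Euc n → ℝ) (hg : Continuous g) (K : Set (Euc n))
    (hK : IsCompact K) : BddAbove (Set.range fun y : K => g y) := by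
  have := (hK.image hg).bddAbove
  rwa [Set.image_eq_range] at this

theorem aux_Psi_mono {n : ℕ} (α : Euc n → ℝ) (hα : Continuous α) (γ : Euc n → ℝ≥0∞)
    (A B : Set (Euc n)) (hA : A.Nonempty) (hAB : A ⊆ B) (hB : IsCompact B) :
    Psi α γ A ≤ Psi α γ B := by
  unfold Psi
  have := hA.to_subtype
  refine mul_le_mul' ?_ (ENNReal.ofReal_le_ofReal ?_)
  · exact iSup_le fun y => le_iSup (fun y : B => γ y) ⟨y, hAB y.2⟩
  · exact ciSup_le fun y => le_ciSup (aux_bdd α hα B hB) ⟨y, hAB y.2⟩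

theorem aux_expNeg_lt {a b : ℝ≥0∞} (h : a < b) : expNeg b < expNeg a := by
  unfold expNeg
  rw [if_neg h.ne_top]
  split_ifs with hb
  · exact Real.exp_pos _
  · exact Real.exp_lt_exp.2 (neg_lt_neg ((ENNReal.toReal_lt_toReal h.ne_top hb).2 h))

theorem aux_expNeg_le {a b : ℝ≥0∞} (h : a ≤ b) : expNeg b ≤ expNeg a := by
  rcases h.eq_or_lt with rfl | h
  · exact le_rfl
  · exact (aux_expNeg_lt h).le

theorem aux_expNeg_zero : expNeg 0 = 1 := by simp [expNeg]

theorem aux_finite {n m : ℕ}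
    (f : Euc n → Euc m → Euc n) (hf : Continuous fun p : Euc n × Euc m => f p.1 p.2)
    (Wd : Set (Euc m)) (hWne : Wd.Nonempty) (hWc : IsCompact Wd)
    (𝒳 : Set (Euc n)) (h𝒳 : IsOpen 𝒳)
    (𝒜 : Set (Euc n)) (h𝒜ne : 𝒜.Nonempty) (h𝒜c : IsCompact 𝒜) (h𝒜𝒳 : 𝒜 ⊆ 𝒳)
    (H : LpStable f Wd 𝒳 𝒜)
    (α : Euc n → ℝ) (αlow αup pbar : ℝ) (hα : AlphaHyp 𝒜 α αlow αup pbar)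
    (hpbar : H.p ≤ pbar)
    (γ : Euc n → ℝ≥0∞) (γlow : ℝ) (hγ : GammaHyp 𝒳 γ γlow)
    (x : Euc n) (hx : x ∈ DOUA f Wd 𝒳 𝒜) : Vval f Wd α γ {x} ≠ ⊤ := by
  obtain ⟨hsafe, hlim⟩ := hx
  obtain ⟨hαc, hαl, hαlu, hαb⟩ := hα
  obtain ⟨hγf, hγc, -, -, -, -⟩ := hγ
  have hcomp := fun k => aux_reach_compact f hf Wd hWne hWc {x} isCompact_singleton k
  have hpp := H.p_pos
  have hr := H.r_pos
  have hM := H.M_ge_one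
  -- boundedness of γ on compact subsets
  have hγK : ∀ K : Set (Euc n), IsCompact K → K ⊆ 𝒳 → ∃ C : ℝ≥0∞, C ≠ ⊤ ∧ ∀ y ∈ K, γ y ≤ C := by
    intro K hK hK𝒳
    rcases K.eq_empty_or_nonempty with rfl | hne
    · exact ⟨0, by simp, by simp⟩
    · obtain ⟨z, hz, hmax⟩ := hK.exists_isMaxOn hne (hγc.mono hK𝒳)
      exact ⟨γ z, hγf z (hK𝒳 hz), fun y hy => hmax hy⟩
  have hfin : ∀ k, Psi α γ (reach f Wd {x} k) ≠ ⊤ := by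
    intro k
    obtain ⟨C, hC, hCb⟩ := hγK _ (hcomp k) (hsafe k)
    refine ENNReal.mul_ne_top (ne_top_of_le_ne_top hC (iSup_le fun y => hCb y y.2))
      ENNReal.ofReal_ne_top
  obtain ⟨δ, hδ, hδ𝒳⟩ := h𝒜c.exists_cthickening_subset_open h𝒳 h𝒜𝒳
  obtain ⟨C, hC, hCb⟩ := hγK _ h𝒜c.cthickening hδ𝒳
  have hev : ∀ᶠ k in atTop, dHa (reach f Wd {x} k) 𝒜 < min δ H.r :=
    hlim.eventually_lt_const (lt_min hδ hr)
  obtain ⟨N, hN⟩ := eventually_atTop.1 hev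
  have hd : ∀ k ≥ N, ∀ y ∈ reach f Wd {x} k, infDist y 𝒜 ≤ min δ H.r := by
    intro k hk y hy
    have h1 := le_ciSup (aux_bdd (fun y => infDist y 𝒜) (continuous_infDist_pt 𝒜) _ (hcomp k))
      ⟨y, hy⟩
    exact h1.trans (hN k hk).le
  have hrI : H.r ∈ Set.Icc (0:ℝ) H.r := ⟨hr.le, le_rfl⟩
  have hαr : ∀ k, ∀ y ∈ reach f Wd {x} (N + k),
      α y ≤ αup * (H.M ^ pbar * (H.r ^ (pbar - H.p) * H.lam H.r k ^ H.p)) := by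
    rintro k y ⟨x', hx', π, hπ, rfl⟩
    have hz : traj f x' π N ∈ reach f Wd {x} N := ⟨x', hx', π, hπ, rfl⟩
    have hzr := (hd N le_rfl _ hz).trans (min_le_right _ _)
    have h1 := H.stab _ (hsafe N hz) hzr (fun j => π (N + j)) (fun j => hπ _) k
    rw [← aux_traj_add] at h1
    have h2 : H.lam (infDist (traj f x' π N) 𝒜) k ≤ H.lam H.r k :=
      H.lam_mono k ⟨infDist_nonneg, hzr⟩ hrI hzr
    have h3 : infDist (traj f x' π (N + k)) 𝒜 ≤ H.M * H.lam H.r k :=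
      h1.trans (mul_le_mul_of_nonneg_left h2 (by linarith))
    have hl0 := H.lam_nonneg H.r hrI k
    have hlr : H.lam H.r k ≤ H.r := (H.lam_anti H.r hrI 0 k (Nat.zero_le _)).trans (H.lam_le_id _ hrI)
    refine (hαb _).2.trans (mul_le_mul_of_nonneg_left ?_ (by linarith))
    refine (Real.rpow_le_rpow infDist_nonneg h3 (by linarith)).trans ?_
    rw [Real.mul_rpow (by linarith) hl0]
    refine mul_le_mul_of_nonneg_left ?_ (Real.rpow_nonneg (by linarith) _)
    have h4 : H.lam H.r k ^ pbar = H.lam H.r k ^ (pbar - H.p) * H.lam H.r k ^ H.p := by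
      rw [← Real.rpow_add_of_nonneg hl0 (by linarith) hpp.le]
      congr 1
      ring
    rw [h4]
    exact mul_le_mul_of_nonneg_right (Real.rpow_le_rpow hl0 hlr (by linarith))
      (Real.rpow_nonneg hl0 _)
  have hPsi : ∀ k, Psi α γ (reach f Wd {x} (k + N)) ≤
      C * ENNReal.ofReal (αup * (H.M ^ pbar * (H.r ^ (pbar - H.p) * H.lam H.r k ^ H.p))) := by
    intro k
    rw [add_comm k N]
    have := (aux_reach_nonempty f Wd hWne x (N + k)).to_subtype
    refine mul_le_mul' (iSup_le fun y => hCb y ?_) (ENNReal.ofReal_le_ofReal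
      (ciSup_le fun y => hαr k y y.2))
    have hyd : infDist (y : Euc n) 𝒜 ≤ δ := (hd (N + k) (by omega) y y.2).trans (min_le_left _ _)
    rw [Metric.mem_cthickening_iff]
    rw [ENNReal.le_ofReal_iff_toReal_le (infEDist_ne_top h𝒜ne) hδ.le]
    exact hyd
  have hsum : Summable fun k => αup * (H.M ^ pbar * (H.r ^ (pbar - H.p) * H.lam H.r k ^ H.p)) :=
    ((H.lam_summable.mul_left _).mul_left _).mul_left _
  have htail : (∑' k, Psi α γ (reach f Wd {x} (k + N))) ≠ ⊤ := by
    refine ne_top_of_le_ne_top ?_ (ENNReal.tsum_le_tsum hPsi)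
    rw [ENNReal.tsum_mul_left]
    exact ENNReal.mul_ne_top hC hsum.tsum_ofReal_ne_top
  unfold Vval
  rw [← ENNReal.summable.sum_add_tsum_nat_add' (f := fun k => Psi α γ (reach f Wd {x} k)) (k := N)]
  exact ENNReal.add_ne_top.2 ⟨ENNReal.sum_ne_top.2 fun k _ => hfin k, htail⟩

theorem stmt19 {n m : ℕ}
    (f : Euc n → Euc m → Euc n) (hf : Continuous fun p : Euc n × Euc m => f p.1 p.2)
    (Wd : Set (Euc m)) (hWne : Wd.Nonempty) (hWc : IsCompact Wd)
    (𝒳 : Set (Euc n)) (h𝒳 : IsOpen 𝒳)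
    (𝒜 : Set (Euc n)) (h𝒜ne : 𝒜.Nonempty) (h𝒜c : IsCompact 𝒜) (h𝒜𝒳 : 𝒜 ⊆ 𝒳)
    (h𝒜inv : ∀ x ∈ 𝒜, ∀ w ∈ Wd, f x w ∈ 𝒜)
    (H : LpStable f Wd 𝒳 𝒜)
    (α : Euc n → ℝ) (αlow αup pbar : ℝ) (hα : AlphaHyp 𝒜 α αlow αup pbar)
    (hpbar : H.p ≤ pbar)
    (γ : Euc n → ℝ≥0∞) (γlow : ℝ) (hγ : GammaHyp 𝒳 γ γlow)
    : (∀ x : Euc n, x ∉ 𝒜 → 0 < Vval f Wd α γ {x} ∧ 0 < Wval f Wd α γ {x}) ∧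
      (∀ x ∈ 𝒜, Vval f Wd α γ {x} = 0 ∧ Wval f Wd α γ {x} = 0) ∧
      (∀ x ∈ DOUA f Wd 𝒳 𝒜 \ 𝒜,
        (⨆ w : Wd, Vval f Wd α γ {f x (w : Euc m)}) < Vval f Wd α γ {x} ∧
        (⨆ w : Wd, Wval f Wd α γ {f x (w : Euc m)}) < Wval f Wd α γ {x}) := by
  have hpp := H.p_pos
  have hPsi0 : ∀ x : Euc n, x ∉ 𝒜 → 0 < Psi α γ (reach f Wd {x} 0) := by
    intro x hx
    rw [aux_reach_zero f Wd hWne]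
    obtain ⟨-, hγc, hγl, hγb, hγo, -⟩ := hγ
    obtain ⟨-, hαl, -, hαb⟩ := hα
    have hd : 0 < infDist x 𝒜 := (h𝒜c.isClosed.notMem_iff_infDist_pos h𝒜ne).1 hx
    have hαx : 0 < α x := lt_of_lt_of_le (mul_pos hαl (Real.rpow_pos_of_pos hd _)) (hαb x).1
    have hγx : 0 < γ x := by
      by_cases h : x ∈ 𝒳
      · exact lt_of_lt_of_le (ENNReal.ofReal_pos.2 hγl) (hγb x h)
      · rw [hγo x h]; simp
    have h1 : (⨆ y : ({x} : Set (Euc n)), γ (y : Euc n)) = γ x := by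
      rw [iSup_unique]; rfl
    have h2 : (⨆ y : ({x} : Set (Euc n)), α (y : Euc n)) = α x := by
      rw [ciSup_unique]; rfl
    unfold Psi
    rw [h1, h2]
    exact ENNReal.mul_pos hγx.ne' (ENNReal.ofReal_pos.2 hαx).ne'
  refine ⟨?_, ?_, ?_⟩
  · intro x hx
    have hV : 0 < Vval f Wd α γ {x} := lt_of_lt_of_le (hPsi0 x hx)
      (ENNReal.le_tsum (f := fun k => Psi α γ (reach f Wd {x} k)) 0)
    refine ⟨hV, ?_⟩
    have := aux_expNeg_lt hV
    rw [aux_expNeg_zero] at this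
    unfold Wval
    linarith
  · intro x hx
    have hin : ∀ (π : ℕ → Euc m), (∀ j, π j ∈ Wd) → ∀ k, traj f x π k ∈ 𝒜 := by
      intro π hπ k
      induction k with
      | zero => exact hx
      | succ k ih => exact h𝒜inv _ ih _ (hπ k)
    have hV : Vval f Wd α γ {x} = 0 := by
      unfold Vval
      rw [ENNReal.tsum_eq_zero]
      intro k
      unfold Psi
      have := (aux_reach_nonempty f Wd hWne x k).to_subtype
      rw [mul_eq_zero]
      right
      rw [ENNReal.ofReal_eq_zero]
      refine ciSup_le ?_
      rintro ⟨y, z, rfl, π, hπ, rfl⟩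
      refine (hα.2.2.2 _).2.trans ?_
      rw [infDist_zero_of_mem (hin π hπ k), Real.zero_rpow (by linarith), mul_zero]
    refine ⟨hV, ?_⟩
    unfold Wval
    rw [hV, aux_expNeg_zero, sub_self]
  · rintro x ⟨hxD, hxA⟩
    have hfin := aux_finite f hf Wd hWne hWc 𝒳 h𝒳 𝒜 h𝒜ne h𝒜c h𝒜𝒳 H α αlow αup pbar hα hpbar
      γ γlow hγ x hxD
    have hVeq : Vval f Wd α γ {x} = Psi α γ (reach f Wd {x} 0) +
        ∑' k, Psi α γ (reach f Wd {x} (k + 1)) :=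
      tsum_eq_zero_add' (f := fun k => Psi α γ (reach f Wd {x} k)) ENNReal.summable
    have hSV : (∑' k, Psi α γ (reach f Wd {x} (k + 1))) < Vval f Wd α γ {x} := by
      have hS : (∑' k, Psi α γ (reach f Wd {x} (k + 1))) ≠ ⊤ := by
        rw [hVeq] at hfin
        exact (ENNReal.add_ne_top.1 hfin).2
      rw [hVeq, add_comm]
      exact ENNReal.lt_add_right hS (hPsi0 x hxA).ne'
    have hle : ∀ w : Wd, Vval f Wd α γ {f x (w : Euc m)} ≤
        ∑' k, Psi α γ (reach f Wd {x} (k + 1)) := fun w =>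
      ENNReal.tsum_le_tsum fun k => aux_Psi_mono α hα.1 γ _ _
        (aux_reach_nonempty f Wd hWne _ k) (aux_reach_step f Wd x w w.2 k)
        (aux_reach_compact f hf Wd hWne hWc {x} isCompact_singleton _)
    have := hWne.to_subtype
    refine ⟨lt_of_le_of_lt (iSup_le hle) hSV, ?_⟩
    refine lt_of_le_of_lt (ciSup_le fun w => sub_le_sub_left (aux_expNeg_le (hle w)) 1) ?_
    exact sub_lt_sub_left (aux_expNeg_lt hSV) 1

end
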